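/- (Identity for Ramanujan's third order mock theta function f, derived in the paper from Proposition 6.3.) For every τ in the complex upper half-plane ℍ, with q := e^{2πiτ}: (∏_{n=1}^∞ (1 − qⁿ)) · f(q) = 1 + 2 Σ_{(x,y) ∈ ℤ², x ≡ 1 (mod 6), y > |x|} χ₁₂(y) · sgn(x) · e^{2πiτ(y² − x²)/24}, where the right-hand series converges absolutely. (Equivalently, q^{−1/24} f(q) = (1/η(τ)) · (1 + 2 Σ_{x ≡ 1 (6), y > |x|} χ₁₂(y) sgn(x) q^{(y²−x²)/24}).) -/

import Mathlib

open Complex Real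

/-- Ramanujan's third order mock theta function
`f(q) = Σ_{n=0}^∞ qⁿ² / ∏_{k=1}^n (1+q^k)²`, for `|q| < 1`. -/
noncomputable def ramanujanF (q : ℂ) : ℂ :=
  ∑' n : ℕ, q ^ (n ^ 2) / (∏ k ∈ Finset.range n, (1 + q ^ (k + 1))) ^ 2

/-- The Kronecker symbol `χ₁₂ = (12/·)`. -/
def chi12 (n : ℤ) : ℤ :=
  if (n : ZMod 12) = 1 ∨ (n : ZMod 12) = 11 then 1
  else if (n : ZMod 12) = 5 ∨ (n : ZMod 12) = 7 then -1
  else 0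

open Filter Topology Finset

section QPochhammer

/-- The finite product `(q; q)_n = ∏_{k=1}^n (1 - q^k)`. -/
noncomputable def qPochhammer (q : ℂ) (n : ℕ) : ℂ := ∏ k ∈ range n, (1 - q ^ (k + 1))

/-- The finite product `(-q; q)_n = ∏_{k=1}^n (1 + q^k)`. -/
noncomputable def negQPochhammer (q : ℂ) (n : ℕ) : ℂ := ∏ k ∈ range n, (1 + q ^ (k + 1))

/-- `1 / (q; q)_{n - r}`, understood as `0` when `n < r`. -/
noncomputable def invQPochhammerSub (q : ℂ) (n r : ℕ) : ℂ :=
  if r ≤ n then (qPochhammer q (n - r))⁻¹ else 0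

variable {q : ℂ}

lemma qPochhammer_succ (q : ℂ) (n : ℕ) :
    qPochhammer q (n + 1) = qPochhammer q n * (1 - q ^ (n + 1)) := prod_range_succ _ _

lemma negQPochhammer_succ (q : ℂ) (n : ℕ) :
    negQPochhammer q (n + 1) = negQPochhammer q n * (1 + q ^ (n + 1)) := prod_range_succ _ _

lemma norm_pow_succ_lt_one (hq : ‖q‖ < 1) (n : ℕ) : ‖q ^ (n + 1)‖ < 1 := by
  rw [norm_pow]
  exact pow_lt_one₀ (norm_nonneg _) hq n.succ_ne_zero

lemma one_sub_pow_succ_ne_zero (hq : ‖q‖ < 1) (n : ℕ) : 1 - q ^ (n + 1) ≠ 0 := by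
  intro h
  have := norm_pow_succ_lt_one hq n
  rw [← sub_eq_zero.mp h] at this
  simp at this

lemma one_add_pow_succ_ne_zero (hq : ‖q‖ < 1) (n : ℕ) : 1 + q ^ (n + 1) ≠ 0 := by
  intro h
  have := norm_pow_succ_lt_one hq n
  rw [← neg_eq_of_add_eq_zero_right h] at this
  simp at this

lemma negQPochhammer_ne_zero (hq : ‖q‖ < 1) (n : ℕ) : negQPochhammer q n ≠ 0 :=
  prod_ne_zero_iff.mpr fun k _ ↦ one_add_pow_succ_ne_zero hq k

lemma inv_qPochhammer_eq (hq : ‖q‖ < 1) (n : ℕ) :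
    (qPochhammer q n)⁻¹ = (1 - q ^ (n + 1)) * (qPochhammer q (n + 1))⁻¹ := by
  rw [qPochhammer_succ, mul_inv, mul_left_comm, mul_inv_cancel₀ (one_sub_pow_succ_ne_zero hq n),
    mul_one]

lemma invQPochhammerSub_succ_succ (n r : ℕ) :
    invQPochhammerSub q (n + 1) (r + 1) = invQPochhammerSub q n r := by
  simp [invQPochhammerSub]

lemma invQPochhammerSub_succ_right (hq : ‖q‖ < 1) {n r : ℕ} (h : r ≤ n) :
    invQPochhammerSub q n (r + 1) = (1 - q ^ (n - r)) * invQPochhammerSub q n r := by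
  obtain ⟨d, rfl⟩ := Nat.exists_eq_add_of_le h
  rcases d with _ | d
  · simp [invQPochhammerSub]
  · rw [invQPochhammerSub, invQPochhammerSub, if_pos (by lia), if_pos (by lia),
      show r + (d + 1) - (r + 1) = d by lia, show r + (d + 1) - r = d + 1 by lia,
      inv_qPochhammer_eq hq]

lemma tendsto_qPochhammer (hq : ‖q‖ < 1) :
    Tendsto (qPochhammer q) atTop (𝓝 (∏' n : ℕ, (1 - q ^ (n + 1)))) :=
  (ModularForm.multipliable_one_sub_pow hq).hasProd.tendsto_prod_nat

lemma tprod_one_sub_pow_succ_ne_zero (hq : ‖q‖ < 1) : ∏' n : ℕ, (1 - q ^ (n + 1)) ≠ 0 := by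
  have := tprod_one_add_ne_zero_of_summable (f := fun n : ℕ ↦ -q ^ (n + 1))
    (fun n ↦ by simpa [← sub_eq_add_neg] using one_sub_pow_succ_ne_zero hq n)
    (by simpa using
      (summable_nat_add_iff 1).mpr (summable_geometric_of_lt_one (norm_nonneg _) hq))
  simpa [← sub_eq_add_neg] using this

lemma tendsto_inv_qPochhammer (hq : ‖q‖ < 1) :
    Tendsto (fun n ↦ (qPochhammer q n)⁻¹) atTop (𝓝 (∏' n : ℕ, (1 - q ^ (n + 1)))⁻¹) :=
  (tendsto_qPochhammer hq).inv₀ (tprod_one_sub_pow_succ_ne_zero hq)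

lemma exists_norm_inv_qPochhammer_le (hq : ‖q‖ < 1) :
    ∃ C : ℝ, 0 ≤ C ∧ ∀ n, ‖(qPochhammer q n)⁻¹‖ ≤ C := by
  obtain ⟨C, hC⟩ := isBounded_iff_forall_norm_le.mp
    (Metric.isBounded_range_of_tendsto _ (tendsto_inv_qPochhammer hq))
  exact ⟨C, (norm_nonneg _).trans (hC _ ⟨0, rfl⟩), fun n ↦ hC _ ⟨n, rfl⟩⟩

lemma norm_invQPochhammerSub_le {C : ℝ} (hC : 0 ≤ C) (h : ∀ n, ‖(qPochhammer q n)⁻¹‖ ≤ C)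
    (n r : ℕ) : ‖invQPochhammerSub q n r‖ ≤ C := by
  unfold invQPochhammerSub
  split_ifs
  · exact h _
  · simpa using hC

end QPochhammer

section BaileyPair

variable {p : ℂ}

/-- The sequence `α` of the Bailey pair relative to `1` with `β n = 1 / (-q; q)_n ^ 2`, where
`q = p ^ 2`. -/
noncomputable def baileyAlpha (p : ℂ) (r : ℕ) : ℂ :=
  if r = 0 then 1 else 4 * (-1) ^ r * p ^ (r * (r + 1)) / (1 + p ^ (2 * r))

lemma baileyAlpha_zero (p : ℂ) : baileyAlpha p 0 = 1 := if_pos rfl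

lemma baileyAlpha_succ (p : ℂ) (r : ℕ) : baileyAlpha p (r + 1) =
    4 * (-1) ^ (r + 1) * p ^ ((r + 1) * (r + 2)) / (1 + (p ^ 2) ^ (r + 1)) := by
  rw [baileyAlpha, if_neg r.succ_ne_zero, pow_mul p 2]

lemma norm_sq_lt_one (hp : ‖p‖ < 1) : ‖p ^ 2‖ < 1 := norm_pow_succ_lt_one hp 1

lemma baileyAlpha_sum_step (hp : ‖p‖ < 1) (n R : ℕ) (hR : R ≤ n + 1) :
    ∑ i ∈ range R, baileyAlpha p (i + 1) *
      ((1 + (p ^ 2) ^ (n + 1)) ^ 2 * invQPochhammerSub (p ^ 2) (n + 1) (i + 1) *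
          (qPochhammer (p ^ 2) (n + 1 + (i + 1)))⁻¹ -
        invQPochhammerSub (p ^ 2) n (i + 1) * (qPochhammer (p ^ 2) (n + (i + 1)))⁻¹) =
      4 * (p ^ 2) ^ (n + 1) / (1 - (p ^ 2) ^ (n + 1)) *
        (-((qPochhammer (p ^ 2) n)⁻¹ * (qPochhammer (p ^ 2) (n + 1))⁻¹) -
          (-1) ^ (R + 1) * p ^ (R * (R + 1)) * invQPochhammerSub (p ^ 2) (n + 1) (R + 1) *
            (qPochhammer (p ^ 2) (n + (R + 1)))⁻¹) := by
  have hq := norm_sq_lt_one hp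
  induction R with
  | zero => simp [invQPochhammerSub]
  | succ i ih =>
    rw [sum_range_succ, ih (by lia), baileyAlpha_succ]
    obtain ⟨d, rfl⟩ := Nat.exists_eq_add_of_le (show i ≤ n by lia)
    rw [← invQPochhammerSub_succ_succ (i + d) (i + 1),
      invQPochhammerSub_succ_right hq (show i + 1 ≤ i + d + 1 by lia),
      show i + d + 1 - (i + 1) = d by lia,
      show i + d + 1 + (i + 1) = i + d + (i + 1) + 1 by ring,
      show i + d + (i + 1 + 1) = i + d + (i + 1) + 1 by ring,
      inv_qPochhammer_eq hq (i + d + (i + 1))]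
    have h1 := one_add_pow_succ_ne_zero hq i
    have h2 := one_sub_pow_succ_ne_zero hq (i + d)
    generalize (qPochhammer (p ^ 2) (i + d + (i + 1) + 1))⁻¹ = A
    generalize invQPochhammerSub (p ^ 2) (i + d + 1) (i + 1) = B
    generalize (qPochhammer (p ^ 2) (i + d + 1))⁻¹ = C
    generalize (qPochhammer (p ^ 2) (i + d))⁻¹ = D
    field_simp
    ring

/-- `1 / (-q; q)_n ^ 2` and `baileyAlpha` form a Bailey pair relative to `1`. -/
lemma sum_baileyAlpha (hp : ‖p‖ < 1) (n : ℕ) :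
    ∑ r ∈ range (n + 1), baileyAlpha p r *
      (invQPochhammerSub (p ^ 2) n r * (qPochhammer (p ^ 2) (n + r))⁻¹) =
      ((negQPochhammer (p ^ 2) n) ^ 2)⁻¹ := by
  have hq := norm_sq_lt_one hp
  induction n with
  | zero => simp [baileyAlpha, invQPochhammerSub, qPochhammer, negQPochhammer]
  | succ n ih =>
    have h := baileyAlpha_sum_step hp n (n + 1) le_rfl
    have h0 : ∀ m, invQPochhammerSub (p ^ 2) m (m + 1) = 0 := fun m ↦ by simp [invQPochhammerSub]
    have hA : ∑ i ∈ range (n + 1), baileyAlpha p (i + 1) * ((1 + (p ^ 2) ^ (n + 1)) ^ 2 *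
          invQPochhammerSub (p ^ 2) (n + 1) (i + 1) * (qPochhammer (p ^ 2) (n + 1 + (i + 1)))⁻¹) =
        (1 + (p ^ 2) ^ (n + 1)) ^ 2 * ∑ i ∈ range (n + 1), baileyAlpha p (i + 1) *
          (invQPochhammerSub (p ^ 2) (n + 1) (i + 1) *
            (qPochhammer (p ^ 2) (n + 1 + (i + 1)))⁻¹) := by
      rw [mul_sum]
      exact sum_congr rfl fun i _ ↦ by ring
    have hB := sum_range_succ (fun i ↦ baileyAlpha p (i + 1) *
      (invQPochhammerSub (p ^ 2) n (i + 1) * (qPochhammer (p ^ 2) (n + (i + 1)))⁻¹)) n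
    simp only [h0, mul_zero, zero_mul, add_zero] at hB
    simp only [mul_sub, sum_sub_distrib, hA, hB, h0, mul_zero, zero_mul, sub_zero] at h
    rw [sum_range_succ' _ n] at ih
    rw [sum_range_succ' _ (n + 1), negQPochhammer_succ]
    have hw : ∀ m, invQPochhammerSub (p ^ 2) m 0 = (qPochhammer (p ^ 2) m)⁻¹ := fun m ↦ by
      simp [invQPochhammerSub]
    rw [eq_sub_of_add_eq ih] at h
    simp only [hw, baileyAlpha_zero, add_zero, one_mul] at h ⊢
    rw [inv_qPochhammer_eq hq n] at h
    have h1 := one_add_pow_succ_ne_zero hq n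
    have h2 := one_sub_pow_succ_ne_zero hq n
    have h3 := negQPochhammer_ne_zero hq n
    have h4 : 4 * (p ^ 2) ^ (n + 1) / (1 - (p ^ 2) ^ (n + 1)) *
        -((1 - (p ^ 2) ^ (n + 1)) * (qPochhammer (p ^ 2) (n + 1))⁻¹ *
          (qPochhammer (p ^ 2) (n + 1))⁻¹) =
        -(4 * (p ^ 2) ^ (n + 1) * ((qPochhammer (p ^ 2) (n + 1))⁻¹) ^ 2) := by
      field_simp
    rw [h4] at h
    refine mul_left_cancel₀ (pow_ne_zero 2 h1) ?_
    have h5 : (1 + (p ^ 2) ^ (n + 1)) ^ 2 *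
        ((negQPochhammer (p ^ 2) n * (1 + (p ^ 2) ^ (n + 1))) ^ 2)⁻¹ =
        (negQPochhammer (p ^ 2) n ^ 2)⁻¹ := by
      field_simp
    rw [h5]
    linear_combination h

end BaileyPair

section DurfeeRectangle

variable {q : ℂ}

/-- The `m`-th term of the sum over Durfee rectangles of size `m × (m + k)`. -/
noncomputable def durfeeTerm (q : ℂ) (k m : ℕ) : ℂ :=
  q ^ (m ^ 2 + m * k) * (qPochhammer q m)⁻¹ * (qPochhammer q (m + k))⁻¹

lemma norm_durfeeTerm_le (hq : ‖q‖ < 1) {C : ℝ} (hC : 0 ≤ C)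
    (h : ∀ n, ‖(qPochhammer q n)⁻¹‖ ≤ C) (k m : ℕ) :
    ‖durfeeTerm q k m‖ ≤ ‖q‖ ^ m * C * C := by
  rw [durfeeTerm, norm_mul, norm_mul, norm_pow]
  have h1 : ‖q‖ ^ (m ^ 2 + m * k) ≤ ‖q‖ ^ m :=
    pow_le_pow_of_le_one (norm_nonneg _) hq.le (by nlinarith [m.zero_le, k.zero_le, m.le_mul_self])
  gcongr
  · exact h _
  · exact h _

lemma summable_norm_pow_mul (hq : ‖q‖ < 1) (C : ℝ) : Summable fun m : ℕ ↦ ‖q‖ ^ m * C * C :=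
  ((summable_geometric_of_lt_one (norm_nonneg _) hq).mul_right C).mul_right C

lemma summable_durfeeTerm (hq : ‖q‖ < 1) (k : ℕ) : Summable (durfeeTerm q k) := by
  obtain ⟨C, hC, h⟩ := exists_norm_inv_qPochhammer_le hq
  exact .of_norm_bounded (summable_norm_pow_mul hq C) (norm_durfeeTerm_le hq hC h k)

lemma tendsto_tsum_durfeeTerm (hq : ‖q‖ < 1) :
    Tendsto (fun k ↦ ∑' m, durfeeTerm q k m) atTop (𝓝 (∏' n : ℕ, (1 - q ^ (n + 1)))⁻¹) := by
  obtain ⟨C, hC, h⟩ := exists_norm_inv_qPochhammer_le hq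
  rw [← tsum_ite_eq (0 : ℕ) fun _ ↦ (∏' n : ℕ, (1 - q ^ (n + 1)))⁻¹]
  refine tendsto_tsum_of_dominated_convergence (summable_norm_pow_mul hq C) (fun m ↦ ?_)
    (.of_forall fun k m ↦ norm_durfeeTerm_le hq hC h k m)
  split_ifs with hm
  · subst hm
    simpa [durfeeTerm, qPochhammer] using tendsto_inv_qPochhammer hq
  · have h1 : Tendsto (fun k ↦ q ^ (m ^ 2 + m * k)) atTop (𝓝 0) :=
      (tendsto_pow_atTop_nhds_zero_of_norm_lt_one hq).comp
        (tendsto_atTop_mono (fun k ↦ (Nat.le_mul_of_pos_left k (Nat.pos_of_ne_zero hm)).trans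
          (Nat.le_add_left _ _)) tendsto_id)
    have h2 : Tendsto (fun k ↦ (qPochhammer q (m + k))⁻¹) atTop
        (𝓝 (∏' n : ℕ, (1 - q ^ (n + 1)))⁻¹) :=
      (tendsto_inv_qPochhammer hq).comp
        (tendsto_atTop_mono (fun k ↦ Nat.le_add_left k m) tendsto_id)
    simpa [durfeeTerm] using (h1.mul_const _).mul h2

lemma durfeeTerm_sub (hq : ‖q‖ < 1) (k m : ℕ) :
    durfeeTerm q k m - durfeeTerm q (k + 1) m =
      q ^ (m ^ 2 + m * k) * (1 - q ^ m - q ^ (m + k + 1)) * (qPochhammer q m)⁻¹ *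
        (qPochhammer q (m + k + 1))⁻¹ := by
  rw [durfeeTerm, durfeeTerm, inv_qPochhammer_eq hq (m + k), ← add_assoc]
  ring

lemma tsum_durfeeTerm_sub (hq : ‖q‖ < 1) (k : ℕ) :
    ∑' m, durfeeTerm q k m - ∑' m, durfeeTerm q (k + 1) m =
      -q ^ (k + 1) * (∑' m, durfeeTerm q (k + 1) m - ∑' m, durfeeTerm q (k + 2) m) := by
  have hs := summable_durfeeTerm hq
  rw [← (hs k).tsum_sub (hs _), ← (hs (k + 1)).tsum_sub (hs _), ← tsum_mul_left]
  set v : ℕ → ℂ := fun m ↦ q ^ (m ^ 2 + m * k + m + k + 1) * (qPochhammer q m)⁻¹ *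
    (qPochhammer q (m + k + 1))⁻¹
  set u : ℕ → ℂ := fun m ↦ q ^ (m ^ 2 + m * k) * (1 - q ^ m) * (qPochhammer q m)⁻¹ *
    (qPochhammer q (m + k + 1))⁻¹
  have hv : Summable v := by
    refine ((hs (k + 1)).mul_left (q ^ (k + 1))).congr fun m ↦ ?_
    simp only [v, durfeeTerm]
    rw [← add_assoc m k 1]
    ring
  have huv : ∀ m, durfeeTerm q k m - durfeeTerm q (k + 1) m = u m - v m := fun m ↦ by
    rw [durfeeTerm_sub hq]
    simp only [u, v]
    ring
  have hu : Summable u := by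
    refine (((hs k).sub (hs (k + 1))).add hv).congr fun m ↦ ?_
    rw [huv]
    ring
  simp_rw [huv]
  rw [hu.tsum_sub hv, hu.tsum_eq_zero_add, show u 0 = 0 by simp [u], zero_add,
    ← ((summable_nat_add_iff 1).mpr hu).tsum_sub hv]
  refine tsum_congr fun m ↦ ?_
  rw [durfeeTerm_sub hq]
  simp only [u, v]
  rw [inv_qPochhammer_eq hq m, inv_qPochhammer_eq hq (m + k + 1),
    show m + 1 + k + 1 = m + k + 1 + 1 by ring, show m + (k + 1) + 1 = m + k + 1 + 1 by ring]
  ring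

/-- The Durfee rectangle identity `∑_m q^(m² + mk) / ((q)_m (q)_{m+k}) = 1 / (q)_∞`. -/
lemma tsum_durfeeTerm (hq : ‖q‖ < 1) (k : ℕ) :
    ∑' m, durfeeTerm q k m = (∏' n : ℕ, (1 - q ^ (n + 1)))⁻¹ := by
  set F : ℕ → ℂ := fun k ↦ ∑' m, durfeeTerm q k m
  have hF : Tendsto F atTop (𝓝 (∏' n : ℕ, (1 - q ^ (n + 1)))⁻¹) := tendsto_tsum_durfeeTerm hq
  have hmono : Monotone fun k ↦ ‖F k - F (k + 1)‖ := monotone_nat_of_le_succ fun k ↦ by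
    simp only [F]
    rw [tsum_durfeeTerm_sub hq k, norm_mul, norm_neg]
    exact mul_le_of_le_one_left (norm_nonneg _) (norm_pow_succ_lt_one hq k).le
  have hlim : Tendsto (fun k ↦ ‖F k - F (k + 1)‖) atTop (𝓝 0) := by
    simpa using (hF.sub (hF.comp (tendsto_add_atTop_nat 1))).norm
  have hconst : ∀ k, F (k + 1) = F k := fun k ↦
    (sub_eq_zero.mp (norm_le_zero_iff.mp (hmono.ge_of_tendsto hlim k))).symm
  have h0 : ∀ k, F k = F 0 := fun k ↦ by
    induction k with
    | zero => rfl
    | succ k ih => rw [hconst, ih]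
  exact (h0 k).trans (tendsto_nhds_unique (hF.congr h0) tendsto_const_nhds).symm

lemma tsum_bailey_weight (hq : ‖q‖ < 1) (r : ℕ) :
    ∑' n, q ^ (n ^ 2) * (invQPochhammerSub q n r * (qPochhammer q (n + r))⁻¹) =
      q ^ (r ^ 2) * (∏' n : ℕ, (1 - q ^ (n + 1)))⁻¹ := by
  rw [← tsum_durfeeTerm hq (2 * r), ← tsum_mul_left,
    ← (add_left_injective r).tsum_eq (f := fun n ↦ q ^ (n ^ 2) *
      (invQPochhammerSub q n r * (qPochhammer q (n + r))⁻¹))]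
  · refine tsum_congr fun m ↦ ?_
    simp only [invQPochhammerSub, durfeeTerm, Nat.le_add_left, if_true, Nat.add_sub_cancel]
    rw [show m + r + r = m + 2 * r by ring]
    ring
  · intro n hn
    by_cases h : r ≤ n
    · exact ⟨n - r, Nat.sub_add_cancel h⟩
    · simp [invQPochhammerSub, h] at hn

end DurfeeRectangle

section Watson

variable {p : ℂ}

lemma exists_norm_baileyAlpha_le (hp : ‖p‖ < 1) :
    ∃ C : ℝ, 0 ≤ C ∧ ∀ r, ‖baileyAlpha p r‖ ≤ C * ‖p‖ ^ r := by
  have hq := norm_sq_lt_one hp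
  have hpos : 0 < 1 - ‖p‖ := sub_pos.mpr hp
  refine ⟨4 / (1 - ‖p‖), by positivity, fun r ↦ ?_⟩
  rcases r with _ | r
  · rw [baileyAlpha_zero, pow_zero, mul_one, norm_one, le_div_iff₀ hpos]
    linarith [norm_nonneg p]
  · rw [baileyAlpha_succ, norm_div, norm_mul, norm_mul, norm_pow, norm_pow, norm_neg, norm_one,
      one_pow, mul_one, div_mul_eq_mul_div]
    have h1 : 1 - ‖p‖ ≤ ‖1 + (p ^ 2) ^ (r + 1)‖ := by
      have h2 := norm_sub_norm_le (1 : ℂ) (-(p ^ 2) ^ (r + 1))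
      rw [norm_one, norm_neg, ← pow_mul, norm_pow, sub_neg_eq_add] at h2
      have h3 : ‖p‖ ^ (2 * (r + 1)) ≤ ‖p‖ :=
        pow_le_of_le_one (norm_nonneg _) hp.le (by lia)
      rw [← pow_mul]
      linarith
    have h4 : ‖p‖ ^ ((r + 1) * (r + 2)) ≤ ‖p‖ ^ (r + 1) :=
      pow_le_pow_of_le_one (norm_nonneg _) hp.le (Nat.le_mul_of_pos_right _ (by lia))
    rw [Complex.norm_ofNat]
    gcongr

lemma tprod_mul_ramanujanF (hp : ‖p‖ < 1) :
    (∏' n : ℕ, (1 - (p ^ 2) ^ (n + 1))) * ramanujanF (p ^ 2) =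
      ∑' r, baileyAlpha p r * (p ^ 2) ^ (r ^ 2) := by
  have hq := norm_sq_lt_one hp
  obtain ⟨C, hC, hC'⟩ := exists_norm_inv_qPochhammer_le hq
  obtain ⟨A, hA, hA'⟩ := exists_norm_baileyAlpha_le hp
  set t : ℕ → ℕ → ℂ := fun n r ↦ baileyAlpha p r *
    ((p ^ 2) ^ (n ^ 2) * (invQPochhammerSub (p ^ 2) n r * (qPochhammer (p ^ 2) (n + r))⁻¹))
  have ht : Summable (Function.uncurry t) := by
    have hb : Summable fun k : ℕ × ℕ ↦ ‖p ^ 2‖ ^ k.1 * (A * C * C * ‖p‖ ^ k.2) :=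
      (summable_geometric_of_lt_one (norm_nonneg _) hq).mul_of_nonneg
        ((summable_geometric_of_lt_one (norm_nonneg _) hp).mul_left _)
        (fun _ ↦ by positivity) (fun _ ↦ by positivity)
    refine .of_norm_bounded hb fun ⟨n, r⟩ ↦ ?_
    simp only [Function.uncurry, t, norm_mul]
    calc _ ≤ (A * ‖p‖ ^ r) * (‖p ^ 2‖ ^ n * (C * C)) := by
          gcongr
          · exact hA' r
          · rw [norm_pow]
            exact pow_le_pow_of_le_one (norm_nonneg _) hq.le (by nlinarith [n.zero_le])
          · exact norm_invQPochhammerSub_le hC hC' n r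
          · exact hC' _
      _ = _ := by ring
  have hf : ramanujanF (p ^ 2) = ∑' n, ∑' r, t n r := by
    refine tsum_congr fun n ↦ ?_
    rw [div_eq_mul_inv]
    change _ * (negQPochhammer (p ^ 2) n ^ 2)⁻¹ = _
    rw [← sum_baileyAlpha hp n, mul_sum, tsum_eq_sum (s := range (n + 1))]
    · exact sum_congr rfl fun r _ ↦ by simp only [t]; ring
    · intro r hr
      have : ¬ r ≤ n := by simpa [Nat.lt_succ_iff] using hr
      simp [t, invQPochhammerSub, this]
  have hne := tprod_one_sub_pow_succ_ne_zero hq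
  rw [hf, ← ht.tsum_comm, ← tsum_mul_left]
  refine tsum_congr fun r ↦ ?_
  simp only [t]
  rw [tsum_mul_left, tsum_bailey_weight hq]
  field_simp

/-- Watson's formula for the mock theta function `f`, with `q = p ^ 2`. -/
lemma tprod_mul_ramanujanF_eq_appell (hp : ‖p‖ < 1) :
    (∏' n : ℕ, (1 - (p ^ 2) ^ (n + 1))) * ramanujanF (p ^ 2) =
      1 + 4 * ∑' n : ℕ, (-1) ^ (n + 1) * p ^ ((n + 1) * (3 * (n + 1) + 1)) /
        (1 + (p ^ 2) ^ (n + 1)) := by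
  have hq := norm_sq_lt_one hp
  obtain ⟨A, hA, hA'⟩ := exists_norm_baileyAlpha_le hp
  have hs : Summable fun r ↦ baileyAlpha p r * (p ^ 2) ^ (r ^ 2) := by
    refine .of_norm_bounded ((summable_geometric_of_lt_one (norm_nonneg _) hp).mul_left A)
      fun r ↦ ?_
    rw [norm_mul, norm_pow (p ^ 2)]
    exact (mul_le_of_le_one_right (norm_nonneg _)
      (pow_le_one₀ (norm_nonneg _) hq.le)).trans (hA' r)
  rw [tprod_mul_ramanujanF hp, hs.tsum_eq_zero_add, baileyAlpha_zero, ← tsum_mul_left]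
  simp only [baileyAlpha_succ]
  congr 1
  · simp
  · refine tsum_congr fun r ↦ ?_
    rw [← pow_mul p 2 ((r + 1) ^ 2),
      show (r + 1) * (3 * (r + 1) + 1) = (r + 1) * (r + 2) + 2 * (r + 1) ^ 2 by ring, pow_add]
    ring

end Watson

section LatticeSums

/-- The odd Dirichlet character modulo `4`, as a function on the integers. -/
def chiNegFour (j : ℤ) : ℤ := if j % 4 = 1 then 1 else if j % 4 = 3 then -1 else 0

lemma chiNegFour_neg (j : ℤ) : chiNegFour (-j) = -chiNegFour j := by
  simp only [chiNegFour]
  split_ifs <;> lia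

lemma chiNegFour_two_mul_add_one (j : ℕ) : chiNegFour (2 * j + 1) = (-1) ^ j := by
  rcases Nat.even_or_odd j with h | h
  · rw [h.neg_one_pow, chiNegFour, if_pos]
    obtain ⟨i, rfl⟩ := h
    push_cast
    lia
  · rw [h.neg_one_pow, chiNegFour, if_neg, if_pos] <;>
    · obtain ⟨i, rfl⟩ := h
      push_cast
      lia

lemma norm_chiNegFour_le (j : ℤ) : ‖(chiNegFour j : ℂ)‖ ≤ 1 := by
  simp only [chiNegFour]
  split_ifs <;> simp

lemma norm_sign_le (j : ℤ) : ‖(j.sign : ℂ)‖ ≤ 1 := by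
  rcases Int.sign_trichotomy j with h | h | h <;> simp [h]

variable {p : ℂ}

/-- The summand `χ₋₄(b - n) p ^ (n b)` at the pair of positive integers
`(n, b) = (k.1 + 1, k.2 + 1)`. -/
noncomputable def pairTerm (p : ℂ) (k : ℕ × ℕ) : ℂ :=
  chiNegFour (k.2 - k.1) * p ^ ((k.1 + 1) * (k.2 + 1))

lemma pairTerm_swap (p : ℂ) (k : ℕ × ℕ) : pairTerm p k.swap = -pairTerm p k := by
  rw [pairTerm, pairTerm, Prod.fst_swap, Prod.snd_swap, ← neg_sub (k.2 : ℤ), chiNegFour_neg,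
    mul_comm (k.2 + 1)]
  push_cast
  ring

lemma summable_norm_pairTerm (hp : ‖p‖ < 1) : Summable fun k ↦ ‖pairTerm p k‖ := by
  have hg := summable_geometric_of_lt_one (norm_nonneg _) hp
  refine .of_nonneg_of_le (fun _ ↦ norm_nonneg _) (fun k ↦ ?_)
    (hg.mul_of_nonneg hg (fun _ ↦ by positivity) fun _ ↦ by positivity)
  rw [pairTerm, norm_mul, norm_pow, ← pow_add]
  exact (mul_le_of_le_one_left (by positivity) (norm_chiNegFour_le _)).trans
    (pow_le_pow_of_le_one (norm_nonneg _) hp.le (by nlinarith [Nat.zero_le (k.1 * k.2)]))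

/-- The part of `pairTerm` supported on `b > 3 n`. -/
noncomputable def coneTerm (p : ℂ) (k : ℕ × ℕ) : ℂ :=
  if 3 * (k.1 + 1) < k.2 + 1 then pairTerm p k else 0

/-- `pairTerm` weighted by the sign of `b - 3 n`. -/
noncomputable def signedTerm (p : ℂ) (k : ℕ × ℕ) : ℂ :=
  (((k.2 + 1 : ℤ) - 3 * (k.1 + 1)).sign : ℂ) * pairTerm p k

/-- The part of `signedTerm` supported on `3 ∤ b`. -/
noncomputable def coprimeTerm (p : ℂ) (k : ℕ × ℕ) : ℂ :=
  if 3 ∣ k.2 + 1 then 0 else signedTerm p k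

lemma summable_coneTerm (hp : ‖p‖ < 1) : Summable (coneTerm p) :=
  .of_norm_bounded (summable_norm_pairTerm hp) fun k ↦ by
    unfold coneTerm
    split_ifs <;> simp

lemma summable_signedTerm (hp : ‖p‖ < 1) : Summable (signedTerm p) :=
  .of_norm_bounded (summable_norm_pairTerm hp) fun k ↦ by
    rw [signedTerm, norm_mul]
    exact mul_le_of_le_one_left (norm_nonneg _) (norm_sign_le _)

lemma summable_coprimeTerm (hp : ‖p‖ < 1) : Summable (coprimeTerm p) :=
  .of_norm_bounded (summable_signedTerm hp).norm fun k ↦ by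
    unfold coprimeTerm
    split_ifs <;> simp

lemma tsum_appell_eq_tsum_coneTerm (hp : ‖p‖ < 1) :
    ∑' n : ℕ, (-1) ^ (n + 1) * p ^ ((n + 1) * (3 * (n + 1) + 1)) / (1 + (p ^ 2) ^ (n + 1)) =
      ∑' k, coneTerm p k := by
  have hq := norm_sq_lt_one hp
  set g : ℕ × ℕ → ℕ × ℕ := fun k ↦ (k.1, 3 * k.1 + 3 + 2 * k.2)
  have hg : Function.Injective g := by
    rintro ⟨a, b⟩ ⟨c, d⟩ h
    simp only [g, Prod.mk.injEq] at h ⊢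
    lia
  have hsum : Summable fun k ↦ coneTerm p (g k) := (summable_coneTerm hp).comp_injective hg
  rw [← hg.tsum_eq (f := coneTerm p), hsum.tsum_prod]
  · refine tsum_congr fun n ↦ ?_
    have hgeom := tsum_geometric_of_norm_lt_one (ξ := -(p ^ 2) ^ (n + 1))
      (by simpa using norm_pow_succ_lt_one hq n)
    rw [sub_neg_eq_add] at hgeom
    rw [div_eq_mul_inv, ← hgeom, ← tsum_mul_left]
    refine tsum_congr fun m ↦ ?_
    simp only [g, coneTerm, pairTerm]
    rw [if_pos (by lia), show ((3 * n + 3 + 2 * m : ℕ) : ℤ) - n = 2 * (n + m + 1 : ℕ) + 1 by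
      push_cast; ring, chiNegFour_two_mul_add_one,
      show (n + 1) * (3 * n + 3 + 2 * m + 1) = (n + 1) * (3 * (n + 1) + 1) + 2 * (n + 1) * m by ring,
      pow_add p, neg_pow ((p ^ 2) ^ (n + 1)), ← pow_mul p 2, ← pow_mul p (2 * (n + 1))]
    push_cast
    ring
  · rintro ⟨n, b⟩ hk
    simp only [Function.mem_support, coneTerm, pairTerm] at hk
    split_ifs at hk with hlt
    · have hodd : ((b : ℤ) - n) % 2 = 1 := by
        by_contra h
        refine hk ?_
        rw [chiNegFour, if_neg (by lia), if_neg (by lia)]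
        simp
      refine ⟨(n, (b - 3 * n - 3) / 2), ?_⟩
      simp only [g, Prod.mk.injEq, true_and]
      lia
    · exact absurd rfl hk

lemma tsum_eq_zero_of_swap {f : ℕ × ℕ → ℂ} (h : ∀ k, f k.swap = -f k) : ∑' k, f k = 0 := by
  have h1 := (Equiv.prodComm ℕ ℕ).tsum_eq f
  simp only [Equiv.prodComm_apply, h, tsum_neg] at h1
  linear_combination (-1 / 2 : ℂ) * h1

lemma tsum_signedTerm (hp : ‖p‖ < 1) : ∑' k, signedTerm p k = 2 * ∑' k, coneTerm p k := by
  have hS := summable_signedTerm hp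
  have hI := summable_coneTerm hp
  rw [← tsum_mul_left, ← sub_eq_zero, ← hS.tsum_sub (hI.mul_left 2)]
  refine tsum_eq_zero_of_swap fun k ↦ ?_
  simp only [signedTerm, coneTerm, pairTerm_swap, Prod.fst_swap, Prod.snd_swap]
  rcases lt_trichotomy (3 * (k.1 + 1)) (k.2 + 1) with h | h | h
  · rw [if_neg (by lia), if_pos h, Int.sign_eq_neg_one_of_neg (by lia),
      Int.sign_eq_one_of_pos (by lia)]
    push_cast
    ring
  · have h0 : pairTerm p k = 0 := by
      rw [pairTerm, chiNegFour, if_neg (by lia), if_neg (by lia)]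
      simp
    simp [h0]
  · rcases lt_or_ge (3 * (k.2 + 1)) (k.1 + 1) with h' | h'
    · rw [if_pos h', if_neg (by lia), Int.sign_eq_one_of_pos (by lia),
        Int.sign_eq_neg_one_of_neg (by lia)]
      push_cast
      ring
    · rcases h'.eq_or_lt with h' | h'
      · have h0 : pairTerm p k = 0 := by
          rw [pairTerm, chiNegFour, if_neg (by lia), if_neg (by lia)]
          simp
        simp [h0]
      · rw [if_neg (by lia), if_neg (by lia), Int.sign_eq_neg_one_of_neg (by lia),
          Int.sign_eq_neg_one_of_neg (by lia)]
        push_cast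
        ring

lemma tsum_signedTerm_three_dvd (p : ℂ) :
    ∑' k : ℕ × ℕ, (if 3 ∣ k.2 + 1 then signedTerm p k else 0) = 0 := by
  set g : ℕ × ℕ → ℕ × ℕ := fun k ↦ (k.1, 3 * k.2 + 2)
  have hg : Function.Injective g := by
    rintro ⟨a, b⟩ ⟨c, d⟩ h
    simp only [g, Prod.mk.injEq] at h ⊢
    lia
  rw [← hg.tsum_eq]
  · refine tsum_eq_zero_of_swap fun k ↦ ?_
    simp only [g, Prod.fst_swap, Prod.snd_swap]
    rw [if_pos (by lia), if_pos (by lia), signedTerm, signedTerm, pairTerm, pairTerm]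
    simp only
    have hsign : ((3 * k.1 + 2 : ℕ) + 1 - 3 * (k.2 + 1) : ℤ).sign =
        -((3 * k.2 + 2 : ℕ) + 1 - 3 * (k.1 + 1) : ℤ).sign := by
      rw [← Int.sign_neg]
      congr 1
      push_cast
      ring
    have hchi : chiNegFour ((3 * k.1 + 2 : ℕ) - k.2) = chiNegFour ((3 * k.2 + 2 : ℕ) - k.1) := by
      simp only [chiNegFour]
      split_ifs <;> lia
    rw [hsign, hchi, show (k.2 + 1) * (3 * k.1 + 2 + 1) = (k.1 + 1) * (3 * k.2 + 2 + 1) by ring]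
    push_cast
    ring
  · rintro ⟨n, b⟩ hk
    by_cases h : 3 ∣ b + 1
    · refine ⟨(n, (b - 2) / 3), ?_⟩
      simp only [g, Prod.mk.injEq, true_and]
      lia
    · simp [h] at hk

lemma tsum_coprimeTerm (hp : ‖p‖ < 1) : ∑' k, coprimeTerm p k = 2 * ∑' k, coneTerm p k := by
  have hS := summable_signedTerm hp
  have hc := summable_coprimeTerm hp
  have h : ∀ k : ℕ × ℕ, signedTerm p k - coprimeTerm p k =
      if 3 ∣ k.2 + 1 then signedTerm p k else 0 := fun k ↦ by
    unfold coprimeTerm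
    split_ifs <;> simp
  rw [← tsum_signedTerm hp, eq_comm, ← sub_eq_zero, ← hS.tsum_sub hc, tsum_congr h,
    tsum_signedTerm_three_dvd]

end LatticeSums

section HeckeForm

lemma intCast_zmod_eq_iff (m : ℕ) (n c : ℤ) (h0 : 0 ≤ c) (h : c < m) :
    (n : ZMod m) = (c : ZMod m) ↔ n % m = c := by
  rw [ZMod.intCast_eq_intCast_iff', Int.emod_eq_of_lt h0 h]

lemma chi12_eq (n : ℤ) : chi12 n =
    if n % 12 = 1 ∨ n % 12 = 11 then 1 else if n % 12 = 5 ∨ n % 12 = 7 then -1 else 0 := by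
  have h1 := intCast_zmod_eq_iff 12 n 1 (by simp) (by simp)
  have h5 := intCast_zmod_eq_iff 12 n 5 (by simp) (by simp)
  have h7 := intCast_zmod_eq_iff 12 n 7 (by simp) (by simp)
  have h11 := intCast_zmod_eq_iff 12 n 11 (by simp) (by simp)
  push_cast at h1 h5 h7 h11
  simp only [chi12, h1, h5, h7, h11]

/-- The nontrivial character modulo `3` at integers coprime to `3`. -/
def chiThree (b : ℤ) : ℤ := if b % 3 = 1 then 1 else -1

lemma chi12_mul_chiThree {n b : ℤ} (hb : ¬ 3 ∣ b) (h : (b - n) % 2 = 1) :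
    chi12 (b + 3 * n) * chiThree b = chiNegFour (b - n) := by
  rw [chi12_eq, chiThree, chiNegFour]
  split_ifs <;> lia

lemma chiNegFour_eq_zero {j : ℤ} (h : j % 2 ≠ 1) : chiNegFour j = 0 := by
  rw [chiNegFour, if_neg (by lia), if_neg (by lia)]

variable {τ : ℂ}

/-- The summand of the indefinite theta series. -/
noncomputable def heckeTerm (τ : ℂ) (k : ℤ × ℤ) : ℂ :=
  if (k.1 : ZMod 6) = 1 ∧ |k.1| < k.2 then
    (chi12 k.2 : ℂ) * (k.1.sign : ℂ) *
      Complex.exp (2 * Real.pi * Complex.I * τ * ((k.2 : ℂ) ^ 2 - (k.1 : ℂ) ^ 2) / 24)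
  else 0

/-- The point `(x, y) = (± (b - 3 n), b + 3 n)` with `x ≡ 1 (mod 6)`, where
`(n, b) = (k.1 + 1, k.2 + 1)`. -/
def heckePoint (k : ℕ × ℕ) : ℤ × ℤ :=
  (chiThree (k.2 + 1) * ((k.2 + 1) - 3 * (k.1 + 1)), (k.2 + 1) + 3 * (k.1 + 1))

lemma coprimeTerm_ne_zero {p : ℂ} {k : ℕ × ℕ} (hk : coprimeTerm p k ≠ 0) :
    ¬ 3 ∣ (k.2 + 1 : ℤ) ∧ (k.2 - k.1 : ℤ) % 2 = 1 := by
  unfold coprimeTerm at hk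
  split_ifs at hk with h
  · exact absurd rfl hk
  · refine ⟨by lia, ?_⟩
    by_contra hc
    simp [signedTerm, pairTerm, chiNegFour_eq_zero hc] at hk

lemma heckeTerm_heckePoint {k : ℕ × ℕ} (hk3 : ¬ 3 ∣ (k.2 + 1 : ℤ))
    (hk2 : (k.2 - k.1 : ℤ) % 2 = 1) :
    heckeTerm τ (heckePoint k) = coprimeTerm (Complex.exp (Real.pi * Complex.I * τ)) k := by
  obtain ⟨n, b⟩ := k
  simp only at hk3 hk2
  have hε : chiThree (b + 1) = 1 ∨ chiThree (b + 1) = -1 := by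
    unfold chiThree
    split_ifs <;> simp
  have hchi := chi12_mul_chiThree (n := n + 1) (b := b + 1) hk3 (by lia)
  have hcond : (((heckePoint (n, b)).1 : ℤ) : ZMod 6) = 1 ∧
      |(heckePoint (n, b)).1| < (heckePoint (n, b)).2 := by
    have := intCast_zmod_eq_iff 6 (heckePoint (n, b)).1 1 (by simp) (by simp)
    push_cast at this
    rw [this, abs_lt]
    simp only [heckePoint, chiThree]
    split_ifs <;> lia
  rw [heckeTerm, if_pos hcond, coprimeTerm, if_neg (by simp only; lia), signedTerm, pairTerm,
    ← Complex.exp_nat_mul, ← mul_assoc]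
  simp only [heckePoint, Int.sign_mul]
  rw [show (b : ℤ) - n = b + 1 - (n + 1) by ring, ← hchi]
  congr 1
  · rcases hε with h | h <;> simp [h, mul_comm]
  · congr 1
    rcases hε with h | h <;> rw [h] <;> push_cast <;> ring

lemma heckePoint_injective : Function.Injective heckePoint := by
  rintro ⟨a, b⟩ ⟨c, d⟩ h
  simp only [heckePoint, chiThree, Prod.mk.injEq] at h ⊢
  split_ifs at h <;> lia

lemma exists_heckePoint_eq {z : ℤ × ℤ} (hz : heckeTerm τ z ≠ 0) :
    ∃ k : ℕ × ℕ, ¬ 3 ∣ (k.2 + 1 : ℤ) ∧ (k.2 - k.1 : ℤ) % 2 = 1 ∧ heckePoint k = z := by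
  obtain ⟨x, y⟩ := z
  unfold heckeTerm at hz
  split_ifs at hz with h
  swap
  · exact absurd rfl hz
  have hy : chi12 y ≠ 0 := by
    rintro h0
    simp [h0] at hz
  obtain ⟨hx, hxy⟩ := h
  have hx' := intCast_zmod_eq_iff 6 x 1 (by simp) (by simp)
  push_cast at hx'
  simp only [hx'] at hx
  rw [abs_lt] at hxy
  obtain hy | hy : y % 6 = 1 ∨ y % 6 = 5 := by
    rw [chi12_eq] at hy
    split_ifs at hy <;> lia
  · refine ⟨(((y - x) / 6 - 1).toNat, ((y + x) / 2 - 1).toNat), ?_⟩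
    simp only [heckePoint, chiThree, Prod.mk.injEq]
    rw [if_pos (by lia)]
    lia
  · refine ⟨(((y + x) / 6 - 1).toNat, ((y - x) / 2 - 1).toNat), ?_⟩
    simp only [heckePoint, chiThree, Prod.mk.injEq]
    rw [if_neg (by lia)]
    lia

lemma hasSum_heckeTerm_iff (a : ℂ) : HasSum (heckeTerm τ) a ↔
    HasSum (coprimeTerm (Complex.exp (Real.pi * Complex.I * τ))) a := by
  refine hasSum_iff_hasSum_of_ne_zero_bij (fun k ↦ heckePoint k.1) ?_ ?_ ?_
  · exact fun k l h ↦ Subtype.ext (heckePoint_injective h)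
  · intro z hz
    obtain ⟨k, hk3, hk2, rfl⟩ := exists_heckePoint_eq hz
    exact ⟨⟨k, by rwa [Function.mem_support, ← heckeTerm_heckePoint hk3 hk2]⟩, rfl⟩
  · rintro ⟨k, hk⟩
    obtain ⟨h3, h2⟩ := coprimeTerm_ne_zero hk
    exact heckeTerm_heckePoint h3 h2

end HeckeForm

/-- Identity for Ramanujan's third order mock theta function `f`:
`(∏_{n≥1}(1 − qⁿ))·f(q) = 1 + 2 Σ_{x ≡ 1 (6), y > |x|} χ₁₂(y) sgn(x) e^{2πiτ(y²−x²)/24}`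
with `q = e^{2πiτ}`, the right-hand series converging absolutely. -/
theorem ramanujanF_identity (τ : ℂ) (hτ : 0 < τ.im) :
    Summable (fun p : ℤ × ℤ =>
      if (p.1 : ZMod 6) = 1 ∧ |p.1| < p.2 then
        (chi12 p.2 : ℂ) * (p.1.sign : ℂ) *
          Complex.exp (2 * Real.pi * Complex.I * τ * ((p.2 : ℂ) ^ 2 - (p.1 : ℂ) ^ 2) / 24)
      else 0) ∧
    (∏' n : ℕ, (1 - Complex.exp (2 * Real.pi * Complex.I * τ) ^ (n + 1))) *
        ramanujanF (Complex.exp (2 * Real.pi * Complex.I * τ)) =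
      1 + 2 * ∑' p : ℤ × ℤ,
        if (p.1 : ZMod 6) = 1 ∧ |p.1| < p.2 then
          (chi12 p.2 : ℂ) * (p.1.sign : ℂ) *
            Complex.exp (2 * Real.pi * Complex.I * τ * ((p.2 : ℂ) ^ 2 - (p.1 : ℂ) ^ 2) / 24)
        else 0 := by
  set p := Complex.exp (Real.pi * Complex.I * τ) with hp_def
  have hp : ‖p‖ < 1 := by
    rw [hp_def, Complex.norm_exp, Real.exp_lt_one_iff]
    simpa using mul_pos Real.pi_pos hτ
  have hq : Complex.exp (2 * Real.pi * Complex.I * τ) = p ^ 2 := by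
    rw [hp_def, ← Complex.exp_nat_mul]
    congr 1
    push_cast
    ring
  have h := (hasSum_heckeTerm_iff _).mpr (summable_coprimeTerm hp).hasSum
  refine ⟨h.summable, ?_⟩
  rw [hq, tprod_mul_ramanujanF_eq_appell hp, tsum_appell_eq_tsum_coneTerm hp]
  change _ = 1 + 2 * ∑' z, heckeTerm τ z
  rw [h.tsum_eq, tsum_coprimeTerm hp]
  ring
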